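/- (Discrete BV bound for the implicit method.) Let u, h : ℤ^d → ℝ be absolutely summable sequences such that u solves one implicit step with data h. Then for every l ∈ {1,…,d}, Σ_{α∈ℤ^d} |u_α − u_{α−e_l}| ≤ Σ_{α∈ℤ^d} |h_α − h_{α−e_l}|, where e_l is the l-th standard basis vector of ℤ^d (and either side may be +∞). -/

import Mathlib

open MeasureTheory Set

noncomputable section

abbrev Ed (d : ℕ) := EuclideanSpace ℝ (Fin d)

def cell (d : ℕ) (dx : ℝ) (α : Fin d → ℤ) : Set (Ed d) :=
  {x | ∀ i, dx * (α i : ℝ) < x i ∧ x i < dx * (α i : ℝ) + dx}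

def ind (d : ℕ) (S : Set (Ed d)) : Ed d → ℝ :=
  S.indicator fun _ => 1

def gam (d : ℕ) (dx : ℝ) (μ : Measure (Ed d)) (l : Fin d) : ℝ :=
  - ∫ z in {z : Ed d | dx / 2 < ‖z‖ ∧ ‖z‖ ≤ 1}, z l ∂μ

def Dup (d : ℕ) (dx : ℝ) (μ : Measure (Ed d)) (l : Fin d) (φ : Ed d → ℝ) (x : Ed d) : ℝ :=
  if 0 < gam d dx μ l then (φ (x + EuclideanSpace.single l dx) - φ x) / dx
  else (φ x - φ (x - EuclideanSpace.single l dx)) / dx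

def Glow (d : ℕ) (dx : ℝ) (μ : Measure (Ed d)) (α β : Fin d → ℤ) : ℝ :=
  (dx ^ d)⁻¹ *
    ∫ x in cell d dx α, ∫ z in {z : Ed d | dx / 2 < ‖z‖},
      (ind d (cell d dx β) (x + z) - ind d (cell d dx β) x) ∂μ

def Gup (d : ℕ) (dx : ℝ) (μ : Measure (Ed d)) (α β : Fin d → ℤ) : ℝ :=
  (dx ^ d)⁻¹ *
    ∑ l : Fin d, gam d dx μ l * ∫ x in cell d dx α, Dup d dx μ l (ind d (cell d dx β)) x

def Gw (d : ℕ) (dx : ℝ) (μ : Measure (Ed d)) (α β : Fin d → ℤ) : ℝ :=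
  Glow d dx μ α β + Gup d dx μ α β

def GsplitLow (d : ℕ) (dx r : ℝ) (μ : Measure (Ed d)) (α β : Fin d → ℤ) : ℝ :=
  (dx ^ d)⁻¹ *
    ∫ x in cell d dx α, ∫ z in {z : Ed d | dx / 2 < ‖z‖ ∧ ‖z‖ ≤ r},
      (ind d (cell d dx β) (x + z) - ind d (cell d dx β) x) ∂μ

def GsplitHigh (d : ℕ) (dx r : ℝ) (μ : Measure (Ed d)) (α β : Fin d → ℤ) : ℝ :=
  (dx ^ d)⁻¹ *
      ∫ x in cell d dx α, ∫ z in {z : Ed d | r < ‖z‖},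
        (ind d (cell d dx β) (x + z) - ind d (cell d dx β) x) ∂μ
    + Gup d dx μ α β

def Aok (A : ℝ → ℝ) (LA : ℝ) : Prop :=
  Monotone A ∧ (∀ a b : ℝ, |A a - A b| ≤ LA * |a - b|) ∧ A 0 = 0

def SolvesImplicitStep (d : ℕ) (dx : ℝ) (μ : Measure (Ed d)) (A : ℝ → ℝ) (dt : ℝ)
    (u h : (Fin d → ℤ) → ℝ) : Prop :=
  ∀ α, Summable (fun β => Gw d dx μ α β * A (u β)) ∧
    u α - dt * ∑' β, Gw d dx μ α β * A (u β) = h α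

def Fractional (d : ℕ) (μ : Measure (Ed d)) (lam clam : ℝ) : Prop :=
  ∀ B : Set (Ed d), MeasurableSet B → B ⊆ {z : Ed d | 0 < ‖z‖ ∧ ‖z‖ < 1} →
    μ B ≤ ∫⁻ z in B, ENNReal.ofReal (clam * ‖z‖ ^ (-(d : ℝ) - lam))

def Lhat (d : ℕ) (dx : ℝ) (μ : Measure (Ed d)) (w : Ed d → ℝ) (x : Ed d) : ℝ :=
  (∫ z in {z : Ed d | dx / 2 < ‖z‖}, (w (x + z) - w x) ∂μ) +
    ∑ l : Fin d, gam d dx μ l * Dup d dx μ l w x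

def Ubar (d : ℕ) (dx : ℝ) (U : (Fin d → ℤ) → ℝ) (x : Ed d) : ℝ :=
  ∑' α : Fin d → ℤ, U α * ind d (cell d dx α) x

def cellAvg (d : ℕ) (dx : ℝ) (w : Ed d → ℝ) (x : Ed d) : ℝ :=
  ∑' α : Fin d → ℤ, Set.indicator (cell d dx α)
    (fun _ => (dx ^ d)⁻¹ * ∫ y in cell d dx α, w y) x

/-- A discrete `ℓ¹` contraction: if `g` is a summable convolution kernel which is nonnegative off the
origin and has nonpositive total mass, and `w` has the same sign as `v`, then
`v - c • (g ⋆ w) = k` implies `‖v‖₁ ≤ ‖k‖₁`. -/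
theorem tsum_abs_le_of_sub_convolution {ι : Type*} [AddCommGroup ι] {g v w k : ι → ℝ} {c : ℝ}
    (hc : 0 ≤ c) (hg : Summable g) (hg0 : ∀ i, i ≠ 0 → 0 ≤ g i) (hgs : ∑' i, g i ≤ 0)
    (hv : Summable fun a => |v a|) (hw : Summable fun a => |w a|) (hk : Summable fun a => |k a|)
    (hsign : ∀ a, ∃ s : ℝ, |s| ≤ 1 ∧ s * v a = |v a| ∧ s * w a = |w a|)
    (heq : ∀ a, v a - c * ∑' i, g i * w (a + i) = k a) :
    ∑' a, |v a| ≤ ∑' a, |k a| := by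
  have hprod : Summable fun p : ι × ι => g p.2 * |w (p.1 + p.2)| := by
    have h1 : Summable fun p : ι × ι => |w p.1| * g p.2 :=
      summable_mul_of_summable_norm (f := fun a => |w a|) (g := g) hw.norm hg.norm
    have h2 := (Equiv.prodShear (Equiv.refl ι) (fun i : ι => Equiv.addRight i)).summable_iff.mpr
      ((Equiv.prodComm ι ι).summable_iff.mpr h1)
    refine ((Equiv.prodComm ι ι).summable_iff.mpr h2).congr fun p => ?_
    simp [Equiv.prodShear, mul_comm]
  have hrow : ∀ a, Summable fun i => g i * |w (a + i)| := fun a => hprod.prod_factor a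
  have hrow' : ∀ a, Summable fun i => g i * w (a + i) := fun a =>
    (summable_norm_iff.mpr (hrow a)).of_norm_bounded fun i => by simp
  have houter : Summable fun a => ∑' i, g i * |w (a + i)| := hprod.prod
  have hsum : ∑' a, ∑' i, g i * |w (a + i)| = (∑' i, g i) * ∑' a, |w a| := by
    rw [← Summable.tsum_comm (f := fun a i => g i * |w (a + i)|) hprod, ← tsum_mul_right]
    refine tsum_congr fun i => ?_
    rw [tsum_mul_left, ← (Equiv.addRight i).tsum_eq fun a => |w a|]
    rfl
  have hpt : ∀ a, |v a| - c * ∑' i, g i * |w (a + i)| ≤ |k a| := by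
    intro a
    obtain ⟨s, hs1, hsv, hsw⟩ := hsign a
    have hle : s * ∑' i, g i * w (a + i) ≤ ∑' i, g i * |w (a + i)| := by
      rw [← tsum_mul_left]
      refine Summable.tsum_le_tsum (fun i => ?_) ((hrow' a).mul_left s) (hrow a)
      rw [mul_left_comm]
      by_cases hi : i = 0
      · subst hi
        rw [add_zero, hsw]
      · refine mul_le_mul_of_nonneg_left ((le_abs_self _).trans ?_) (hg0 i hi)
        rw [abs_mul]
        exact mul_le_of_le_one_left (abs_nonneg _) hs1
    have hks : s * k a ≤ |k a| := by
      refine (le_abs_self _).trans ?_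
      rw [abs_mul]
      exact mul_le_of_le_one_left (abs_nonneg _) hs1
    rw [← heq a, mul_sub, hsv, mul_left_comm, heq a] at hks
    linarith [mul_le_mul_of_nonneg_left hle hc]
  have hfin := Summable.tsum_le_tsum hpt (hv.sub (houter.mul_left c)) hk
  rw [hv.tsum_sub (houter.mul_left c), tsum_mul_left, hsum] at hfin
  have hneg : c * ((∑' i, g i) * ∑' a, |w a|) ≤ 0 :=
    mul_nonpos_of_nonneg_of_nonpos hc
      (mul_nonpos_of_nonpos_of_nonneg hgs (tsum_nonneg fun _ => abs_nonneg _))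
  linarith

/-- A kernel which is nonnegative off the origin and whose finite sums over sets containing the
origin are nonpositive is summable, with nonpositive total mass. -/
theorem summable_and_tsum_nonpos_of_sum_insert_nonpos {ι : Type*} [Zero ι] {g : ι → ℝ}
    (hg0 : ∀ i, i ≠ 0 → 0 ≤ g i) (hF : ∀ F : Finset ι, 0 ∈ F → ∑ i ∈ F, g i ≤ 0) :
    Summable g ∧ ∑' i, g i ≤ 0 := by
  classical
  have hs : Summable (Function.update g 0 0) := by
    refine summable_of_sum_le (c := -g 0) (fun i => ?_) fun F => ?_
    · by_cases hi : i = 0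
      · simp [hi]
      · simpa [hi] using hg0 i hi
    · have h1 := hF (insert 0 F) (Finset.mem_insert_self _ _)
      rw [← Finset.add_sum_erase _ _ (Finset.mem_insert_self _ _), Finset.erase_insert_eq_erase] at h1
      have h2 : ∑ i ∈ F, Function.update g 0 0 i = ∑ i ∈ F.erase 0, g i := by
        rw [← Finset.sum_erase F (a := 0) (by simp)]
        exact Finset.sum_congr rfl fun i hi => by simp [Finset.ne_of_mem_erase hi]
      linarith
  have hg : Summable g := by
    have := hs.update 0 (g 0)
    simpa using this
  refine ⟨hg, le_of_tendsto hg.hasSum ?_⟩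
  filter_upwards [Filter.eventually_ge_atTop {0}] with F hF0
  exact hF F (hF0 (Finset.mem_singleton_self 0))

theorem Monotone.exists_sign_mul_sub {A : ℝ → ℝ} (hA : Monotone A) (x y : ℝ) :
    ∃ s : ℝ, |s| ≤ 1 ∧ s * (x - y) = |x - y| ∧ s * (A x - A y) = |A x - A y| := by
  rcases le_total x y with hxy | hxy
  · refine ⟨-1, by simp, ?_, ?_⟩
    · rw [abs_of_nonpos (sub_nonpos.mpr hxy), neg_one_mul]
    · rw [abs_of_nonpos (sub_nonpos.mpr (hA hxy)), neg_one_mul]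
  · refine ⟨1, by simp, ?_, ?_⟩
    · rw [abs_of_nonneg (sub_nonneg.mpr hxy), one_mul]
    · rw [abs_of_nonneg (sub_nonneg.mpr (hA hxy)), one_mul]

section Weights

variable {d : ℕ} {dx : ℝ} {μ : Measure (Ed d)}

theorem isFiniteMeasure_restrict_of_lintegral_min (hdx0 : 0 < dx)
    (hμfin : ∫⁻ z, ENNReal.ofReal (min (‖z‖ ^ 2) 1) ∂μ < ⊤) :
    IsFiniteMeasure (μ.restrict {z : Ed d | dx / 2 < ‖z‖}) := by
  rw [isFiniteMeasure_restrict]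
  have hpos : 0 < ENNReal.ofReal (min ((dx / 2) ^ 2) 1) := by
    rw [ENNReal.ofReal_pos]
    positivity
  refine ne_top_of_le_ne_top (ENNReal.div_ne_top hμfin.ne hpos.ne')
    ((measure_mono fun z hz => ?_).trans
      (meas_ge_le_lintegral_div (by fun_prop) hpos.ne' ENNReal.ofReal_ne_top))
  have hz' : dx / 2 < ‖z‖ := hz
  exact ENNReal.ofReal_le_ofReal (min_le_min_right _ (by gcongr))

theorem cell_eq_preimage (α : Fin d → ℤ) :
    cell d dx α = (WithLp.ofLp : Ed d → Fin d → ℝ) ⁻¹'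
      Set.pi univ fun i => Ioo (dx * (α i : ℝ)) (dx * (α i : ℝ) + dx) := by
  ext x
  simp [cell]

theorem measurableSet_cell (α : Fin d → ℤ) : MeasurableSet (cell d dx α) := by
  rw [cell_eq_preimage]
  exact (PiLp.volume_preserving_ofLp (Fin d)).measurable
    (MeasurableSet.univ_pi fun _ => measurableSet_Ioo)

theorem volume_cell_ne_top (α : Fin d → ℤ) : volume (cell d dx α) ≠ ⊤ := by
  rw [cell_eq_preimage, (PiLp.volume_preserving_ofLp (Fin d)).measure_preimage
    (MeasurableSet.univ_pi fun _ => measurableSet_Ioo).nullMeasurableSet, Real.volume_pi_Ioo]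
  exact ENNReal.prod_ne_top fun _ _ => ENNReal.ofReal_ne_top

theorem eq_of_mem_cell (hdx0 : 0 < dx) {α β : Fin d → ℤ} {x : Ed d} (hα : x ∈ cell d dx α)
    (hβ : x ∈ cell d dx β) : α = β := by
  funext i
  obtain ⟨h1, h2⟩ := hα i
  obtain ⟨h3, h4⟩ := hβ i
  have key : ∀ m n : ℤ, dx * (m : ℝ) < dx * (n : ℝ) + dx → m ≤ n := by
    intro m n h
    have h' : (m : ℝ) < n + 1 := by
      refine lt_of_mul_lt_mul_left ?_ hdx0.le
      linarith
    exact Int.lt_add_one_iff.mp (by exact_mod_cast h')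
  exact le_antisymm (key _ _ (by linarith)) (key _ _ (by linarith))

theorem measurable_ind_cell (α : Fin d → ℤ) : Measurable (ind d (cell d dx α)) :=
  measurable_const.indicator (measurableSet_cell α)

theorem ind_of_notMem {S : Set (Ed d)} {x : Ed d} (hx : x ∉ S) : ind d S x = 0 :=
  indicator_of_notMem hx _

theorem ind_nonneg (S : Set (Ed d)) (x : Ed d) : 0 ≤ ind d S x :=
  indicator_nonneg (fun _ _ => zero_le_one) x

theorem ind_le_one (S : Set (Ed d)) (x : Ed d) : ind d S x ≤ 1 :=
  indicator_le_self' (fun _ _ => zero_le_one) x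

theorem abs_ind_le_one (S : Set (Ed d)) (x : Ed d) : |ind d S x| ≤ 1 := by
  rw [abs_of_nonneg (ind_nonneg S x)]
  exact ind_le_one S x

theorem sum_ind_cell_le_one (hdx0 : 0 < dx) (F : Finset (Fin d → ℤ)) (x : Ed d) :
    ∑ β ∈ F, ind d (cell d dx β) x ≤ 1 := by
  by_cases hx : ∃ β ∈ F, x ∈ cell d dx β
  · obtain ⟨β, hβF, hβ⟩ := hx
    rw [Finset.sum_eq_single_of_mem β hβF fun γ _ hγ =>
      ind_of_notMem fun hx => hγ (eq_of_mem_cell hdx0 hx hβ)]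
    exact ind_le_one _ _
  · push Not at hx
    rw [Finset.sum_eq_zero fun β hβ => ind_of_notMem (hx β hβ)]
    exact zero_le_one

theorem sum_ind_cell_eq_one (hdx0 : 0 < dx) {F : Finset (Fin d → ℤ)} {α : Fin d → ℤ} (hα : α ∈ F)
    {x : Ed d} (hx : x ∈ cell d dx α) : ∑ β ∈ F, ind d (cell d dx β) x = 1 := by
  rw [Finset.sum_eq_single_of_mem α hα fun γ _ hγ =>
    ind_of_notMem fun hx' => hγ (eq_of_mem_cell hdx0 hx' hx)]
  exact indicator_of_mem hx _

theorem Lhat_nonneg (hdx0 : 0 < dx) {φ : Ed d → ℝ} {x : Ed d} (hx : ∀ y, φ x ≤ φ y) :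
    0 ≤ Lhat d dx μ φ x := by
  refine add_nonneg (integral_nonneg fun z => sub_nonneg.mpr (hx _))
    (Finset.sum_nonneg fun l _ => ?_)
  unfold Dup
  split_ifs with hl
  · exact mul_nonneg hl.le (div_nonneg (sub_nonneg.mpr (hx _)) hdx0.le)
  · exact mul_nonneg_of_nonpos_of_nonpos (not_lt.mp hl)
      (div_nonpos_of_nonpos_of_nonneg (sub_nonpos.mpr (hx _)) hdx0.le)

theorem Lhat_nonpos (hdx0 : 0 < dx) {φ : Ed d → ℝ} {x : Ed d} (hx : ∀ y, φ y ≤ φ x) :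
    Lhat d dx μ φ x ≤ 0 := by
  refine add_nonpos (integral_nonpos fun z => sub_nonpos.mpr (hx _))
    (Finset.sum_nonpos fun l _ => ?_)
  unfold Dup
  split_ifs with hl
  · exact mul_nonpos_of_nonneg_of_nonpos hl.le
      (div_nonpos_of_nonpos_of_nonneg (sub_nonpos.mpr (hx _)) hdx0.le)
  · exact mul_nonpos_of_nonpos_of_nonneg (not_lt.mp hl)
      (div_nonneg (sub_nonneg.mpr (hx _)) hdx0.le)

theorem Lhat_comp_add_right (φ : Ed d → ℝ) (t x : Ed d) :
    Lhat d dx μ (fun y => φ (y + t)) x = Lhat d dx μ φ (x + t) := by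
  simp only [Lhat, Dup, add_right_comm x _ t, sub_add_eq_add_sub]

theorem integrable_difference {ν : Measure (Ed d)} [IsFiniteMeasure ν] {φ : Ed d → ℝ}
    (hφ : Measurable φ) {C : ℝ} (hC : ∀ y, |φ y| ≤ C) (x : Ed d) :
    Integrable (fun z => φ (x + z) - φ x) ν :=
  (Integrable.of_bound (hφ.comp (measurable_const_add x)).aestronglyMeasurable C (by simpa using .of_forall fun z => hC (x + z))).sub
    (integrable_const _)

theorem Lhat_sum {ι : Type*} (F : Finset ι) {φ : ι → Ed d → ℝ}
    [IsFiniteMeasure (μ.restrict {z : Ed d | dx / 2 < ‖z‖})] (hφ : ∀ i, Measurable (φ i)) {C : ℝ}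
    (hC : ∀ i y, |φ i y| ≤ C) (x : Ed d) :
    Lhat d dx μ (fun y => ∑ i ∈ F, φ i y) x = ∑ i ∈ F, Lhat d dx μ (φ i) x := by
  have hD : ∀ l, Dup d dx μ l (fun y => ∑ i ∈ F, φ i y) x = ∑ i ∈ F, Dup d dx μ l (φ i) x := by
    intro l
    unfold Dup
    split_ifs <;> rw [← Finset.sum_sub_distrib, Finset.sum_div]
  simp only [Lhat, hD, ← Finset.sum_sub_distrib, Finset.mul_sum, Finset.sum_add_distrib]
  rw [integral_finsetSum _ fun i _ => integrable_difference (hφ i) (hC i) x, Finset.sum_comm]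

theorem integrableOn_cell_Dup (α : Fin d → ℤ) {φ : Ed d → ℝ} (hφ : Measurable φ) {C : ℝ}
    (hC : ∀ y, |φ y| ≤ C) (l : Fin d) : IntegrableOn (Dup d dx μ l φ) (cell d dx α) := by
  have hb : ∀ f : Ed d → Ed d, Measurable f → IntegrableOn (fun x => φ (f x)) (cell d dx α) :=
    fun f hf => Measure.integrableOn_of_bounded (M := C) (volume_cell_ne_top α)
      (hφ.comp hf).aestronglyMeasurable (.of_forall fun x => hC (f x))
  unfold Dup
  split_ifs
  · exact ((hb _ (measurable_id.add_const _)).sub (hb _ measurable_id)).div_const _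
  · exact ((hb _ measurable_id).sub (hb _ (measurable_id.sub_const _))).div_const _

theorem integrableOn_cell_integral_difference {ν : Measure (Ed d)} [IsFiniteMeasure ν]
    (α : Fin d → ℤ) {φ : Ed d → ℝ} (hφ : Measurable φ) {C : ℝ} (hC : ∀ y, |φ y| ≤ C) :
    IntegrableOn (fun x => ∫ z, (φ (x + z) - φ x) ∂ν) (cell d dx α) := by
  have hm : StronglyMeasurable fun p : Ed d × Ed d => φ (p.1 + p.2) - φ p.1 :=
    Measurable.stronglyMeasurable (by fun_prop)
  refine Measure.integrableOn_of_bounded (M := (C + C) * ν.real univ) (volume_cell_ne_top α)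
    hm.integral_prod_right'.aestronglyMeasurable (.of_forall fun x => ?_)
  exact norm_integral_le_of_norm_le_const (.of_forall fun z =>
    (norm_sub_le _ _).trans (add_le_add (hC _) (hC _)))

theorem integrableOn_cell_Lhat [IsFiniteMeasure (μ.restrict {z : Ed d | dx / 2 < ‖z‖})]
    (α : Fin d → ℤ) {φ : Ed d → ℝ} (hφ : Measurable φ) {C : ℝ} (hC : ∀ y, |φ y| ≤ C) :
    IntegrableOn (Lhat d dx μ φ) (cell d dx α) :=
  (integrableOn_cell_integral_difference α hφ hC).add
    (integrable_finsetSum _ fun l _ => (integrableOn_cell_Dup α hφ hC l).const_mul _)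

theorem Gw_eq_integral_Lhat [IsFiniteMeasure (μ.restrict {z : Ed d | dx / 2 < ‖z‖})]
    (α β : Fin d → ℤ) :
    Gw d dx μ α β = (dx ^ d)⁻¹ * ∫ x in cell d dx α, Lhat d dx μ (ind d (cell d dx β)) x := by
  have hm := measurable_ind_cell (dx := dx) β
  have hC := abs_ind_le_one (cell d dx β)
  have hD := fun l : Fin d => (integrableOn_cell_Dup (dx := dx) (μ := μ) α hm hC l).const_mul (gam d dx μ l)
  unfold Lhat
  rw [Gw, Glow, Gup, ← mul_add, integral_add (integrableOn_cell_integral_difference α hm hC)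
    (integrable_finsetSum _ fun l _ => hD l), integral_finsetSum _ fun l _ => hD l]
  simp only [integral_const_mul]

theorem Gw_nonneg [IsFiniteMeasure (μ.restrict {z : Ed d | dx / 2 < ‖z‖})] (hdx0 : 0 < dx)
    {α β : Fin d → ℤ} (hαβ : α ≠ β) : 0 ≤ Gw d dx μ α β := by
  rw [Gw_eq_integral_Lhat]
  refine mul_nonneg (by positivity) (setIntegral_nonneg (measurableSet_cell α) fun x hx => ?_)
  refine Lhat_nonneg hdx0 fun y => ?_
  rw [ind_of_notMem fun hx' => hαβ (eq_of_mem_cell hdx0 hx hx')]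
  exact ind_nonneg _ _

theorem sum_Gw_nonpos [IsFiniteMeasure (μ.restrict {z : Ed d | dx / 2 < ‖z‖})] (hdx0 : 0 < dx)
    {α : Fin d → ℤ} {F : Finset (Fin d → ℤ)} (hα : α ∈ F) : ∑ β ∈ F, Gw d dx μ α β ≤ 0 := by
  have hm := fun β : Fin d → ℤ => measurable_ind_cell (dx := dx) β
  have hC := fun β : Fin d → ℤ => abs_ind_le_one (cell d dx β)
  simp only [Gw_eq_integral_Lhat]
  rw [← Finset.mul_sum,
    ← integral_finsetSum _ fun β _ => integrableOn_cell_Lhat (μ := μ) α (hm β) (hC β)]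
  simp only [← Lhat_sum F hm hC]
  refine mul_nonpos_of_nonneg_of_nonpos (by positivity)
    (setIntegral_nonpos (measurableSet_cell α) fun x hx => Lhat_nonpos hdx0 fun y => ?_)
  rw [sum_ind_cell_eq_one hdx0 hα hx]
  exact sum_ind_cell_le_one hdx0 F y

theorem add_mem_cell_add_iff (α β : Fin d → ℤ) (x : Ed d) :
    x + WithLp.toLp 2 (fun i => dx * (α i : ℝ)) ∈ cell d dx (α + β) ↔ x ∈ cell d dx β := by
  refine forall_congr' fun i => ?_
  simp only [PiLp.add_apply, Pi.add_apply, Int.cast_add, mul_add]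
  constructor <;> rintro ⟨h1, h2⟩ <;> constructor <;> linarith

theorem Gw_add_right [IsFiniteMeasure (μ.restrict {z : Ed d | dx / 2 < ‖z‖})]
    (α k : Fin d → ℤ) : Gw d dx μ α (α + k) = Gw d dx μ 0 k := by
  set t : Ed d := WithLp.toLp 2 fun i => dx * (α i : ℝ) with ht
  have hcell : (fun x : Ed d => x + t) ⁻¹' cell d dx α = cell d dx 0 := by
    ext x
    simpa using add_mem_cell_add_iff (dx := dx) α 0 x
  have hind : (fun y => ind d (cell d dx (α + k)) (y + t)) = ind d (cell d dx k) := by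
    classical
    funext y
    simp only [ind, indicator_apply, ht, add_mem_cell_add_iff]
  rw [Gw_eq_integral_Lhat, Gw_eq_integral_Lhat,
    ← (measurePreserving_add_right volume t).setIntegral_preimage_emb
      (MeasurableEquiv.addRight t).measurableEmbedding, hcell]
  simp only [← Lhat_comp_add_right, hind]

end Weights

theorem stmt14 (d : ℕ) (hd : 1 ≤ d) (dx : ℝ) (hdx0 : 0 < dx) (hdx1 : dx < 1)
    (μ : Measure (Ed d)) (hμ0 : μ {0} = 0)
    (hμfin : ∫⁻ z, ENNReal.ofReal (min (‖z‖ ^ 2) 1) ∂μ < ⊤)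
    (A : ℝ → ℝ) (LA : ℝ) (hA : Aok A LA) (dt : ℝ) (hdt : 0 < dt)
    (u h : (Fin d → ℤ) → ℝ)
    (hu : Summable fun α => |u α|) (hh : Summable fun α => |h α|)
    (hstep : SolvesImplicitStep d dx μ A dt u h) :
    ∀ l : Fin d,
      ∑' α : Fin d → ℤ, ENNReal.ofReal |u α - u (α - Pi.single l 1)| ≤
        ∑' α : Fin d → ℤ, ENNReal.ofReal |h α - h (α - Pi.single l 1)| := by
  intro l
  have := isFiniteMeasure_restrict_of_lintegral_min hdx0 hμfin
  obtain ⟨hAmono, hALip, hA0⟩ := hA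
  set e : Fin d → ℤ := Pi.single l 1
  obtain ⟨hg, hgs⟩ := summable_and_tsum_nonpos_of_sum_insert_nonpos (g := Gw d dx μ 0)
    (fun k hk => Gw_nonneg hdx0 hk.symm) (fun F hF => sum_Gw_nonpos hdx0 hF)
  have hshift : ∀ f : (Fin d → ℤ) → ℝ, (Summable fun α => |f α|) →
      Summable fun α => |f α - f (α - e)| := by
    intro f hf
    have hf' : Summable fun α => |f (α - e)| := (Equiv.subRight e).summable_iff.mpr hf
    exact (hf.add hf').of_nonneg_of_le (fun _ => abs_nonneg _) fun α => abs_sub _ _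
  have hAu : Summable fun α => |A (u α)| :=
    (hu.mul_left LA).of_nonneg_of_le (fun _ => abs_nonneg _) fun α => by
      simpa [hA0] using hALip (u α) 0
  have hconv : ∀ α, (Summable fun k => Gw d dx μ 0 k * A (u (α + k))) ∧
      u α - dt * ∑' k, Gw d dx μ 0 k * A (u (α + k)) = h α := by
    intro α
    obtain ⟨h1, h2⟩ := hstep α
    rw [← (Equiv.addLeft α).summable_iff] at h1
    rw [← (Equiv.addLeft α).tsum_eq] at h2
    simp only [Function.comp_def, Equiv.coe_addLeft, Gw_add_right] at h1 h2
    exact ⟨h1, h2⟩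
  have hmain : ∑' α, |u α - u (α - e)| ≤ ∑' α, |h α - h (α - e)| := by
    refine tsum_abs_le_of_sub_convolution (g := Gw d dx μ 0)
      (w := fun α => A (u α) - A (u (α - e))) hdt.le hg (fun k hk => Gw_nonneg hdx0 hk.symm) hgs
      (hshift u hu) (hshift (fun α => A (u α)) hAu) (hshift h hh)
      (fun α => hAmono.exists_sign_mul_sub _ _) fun α => ?_
    obtain ⟨h1, h2⟩ := hconv α
    obtain ⟨h3, h4⟩ := hconv (α - e)
    simp only [mul_sub, add_sub_right_comm α _ e]
    rw [h1.tsum_sub h3, ← h2, ← h4]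
    ring
  rw [← ENNReal.ofReal_tsum_of_nonneg (fun _ => abs_nonneg _) (hshift u hu),
    ← ENNReal.ofReal_tsum_of_nonneg (fun _ => abs_nonneg _) (hshift h hh)]
  exact ENNReal.ofReal_le_ofReal hmain
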